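/- arXiv:2506.20086 — 11 statements merged into one kernel-verified Lean document; each statement's English description precedes it below -/
import Mathlib

section
/- The Herschel graph 𝔥 is not hamiltonian. -/
/-- Vertex labels: `0 = h¹`, `1 = h²`, `2 = h₁`, `3 = h₂`, `4 = h₃`,
`5 = h₁¹`, `6 = h₂¹`, `7 = h₃¹`, `8 = h₁²`, `9 = h₂²`, `10 = h₃²`. -/
def herschelEdges : List (Fin 11 × Fin 11) :=
  [(0,5),(0,6),(0,7),(1,8),(1,9),(1,10),
   (2,5),(2,8),(2,7),(2,10),
   (3,6),(3,9),(3,5),(3,8),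
   (4,7),(4,10),(4,6),(4,9)]

/-- The Herschel graph `𝔥`. -/
def Herschel : SimpleGraph (Fin 11) :=
  SimpleGraph.fromRel (fun a b => (a, b) ∈ herschelEdges)

/-- The bipartition of the Herschel graph into its parts of sizes `5` and `6`. -/
def herschelColoring : Herschel.Coloring Bool :=
  SimpleGraph.Coloring.mk (fun v => decide (v < 5)) (by
    unfold Herschel
    simp only [SimpleGraph.fromRel_adj]
    decide)

theorem herschel_not_hamiltonian : ¬ Herschel.IsHamiltonian := by
  intro h
  obtain ⟨_, p, hp⟩ := h (by simp)
  have heven : Even p.length := (herschelColoring.even_length_iff_congr p).2 Iff.rfl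
  rw [hp.length_eq, Fintype.card_fin] at heven
  exact absurd heven (by decide)
end

section
/- The Herschel graph 𝔥 is 3-connected. -/
/-- A graph is 3-connected if it has more than 3 vertices and removing any set of
at most 2 vertices leaves the induced subgraph on the remaining vertices connected. -/
def ThreeConnected {V : Type*} [Fintype V] (G : SimpleGraph V) : Prop :=
  3 < Fintype.card V ∧
    ∀ S : Finset V, S.card ≤ 2 → (G.induce ((↑S : Set V)ᶜ)).Connected

/-- One pass over the edge list `L`, adding to the vertices already `reached` every vertex outside
`S` that is joined to one of them. -/
def extendReached {V : Type*} [DecidableEq V] (S : Finset V) : List (V × V) → List V → List V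
  | [], reached => reached
  | (a, b) :: L, reached =>
      if a ∈ reached ∧ b ∉ S then extendReached S L (reached.insert b)
      else if b ∈ reached ∧ a ∉ S then extendReached S L (reached.insert a)
      else extendReached S L reached

theorem extendReached_induction {V : Type*} [DecidableEq V] {S : Finset V} {p : V → Prop}
    {L : List (V × V)} {reached : List V}
    (hL : ∀ a b, (a, b) ∈ L → a ∉ S → b ∉ S → (p a ↔ p b))
    (hS : ∀ v ∈ reached, v ∉ S) (hp : ∀ v ∈ reached, p v) :
    ∀ v ∈ extendReached S L reached, v ∉ S ∧ p v := by
  induction L generalizing reached with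
  | nil => exact fun v hv => ⟨hS v hv, hp v hv⟩
  | cons e L ih =>
    obtain ⟨a, b⟩ := e
    have hL' : ∀ a b, (a, b) ∈ L → a ∉ S → b ∉ S → (p a ↔ p b) :=
      fun a b h => hL a b (List.mem_cons_of_mem _ h)
    have hab := hL a b List.mem_cons_self
    simp only [extendReached]
    split_ifs <;> apply ih hL' <;> grind

theorem connected_induce_compl_of_extendReached {V : Type*} [DecidableEq V]
    (G : SimpleGraph V) {L : List (V × V)} (hL : ∀ a b, (a, b) ∈ L → G.Adj a b) {S : Finset V}
    (n : ℕ) (h : ∃ r, r ∉ S ∧ ∀ v, v ∉ S → v ∈ (extendReached S L)^[n] [r]) :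
    (G.induce ((↑S : Set V)ᶜ)).Connected := by
  obtain ⟨r, hr, hreach⟩ := h
  let H := G.induce ((↑S : Set V)ᶜ)
  let p : V → Prop := fun v => ∃ h : v ∉ S, H.Reachable ⟨r, hr⟩ ⟨v, h⟩
  have hp : ∀ a b, (a, b) ∈ L → a ∉ S → b ∉ S → (p a ↔ p b) := by
    intro a b hab ha hb
    have hadj : H.Adj ⟨a, ha⟩ ⟨b, hb⟩ := hL a b hab
    exact ⟨fun ⟨_, h⟩ => ⟨hb, h.trans hadj.reachable⟩,
      fun ⟨_, h⟩ => ⟨ha, h.trans hadj.symm.reachable⟩⟩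
  have hmem : ∀ v ∈ (extendReached S L)^[n] [r], v ∉ S ∧ p v := by
    clear hreach
    induction n with
    | zero => simpa using And.intro hr (show p r from ⟨hr, .rfl⟩)
    | succ n ih =>
      rw [Function.iterate_succ_apply']
      exact extendReached_induction hp (fun v hv => (ih v hv).1) (fun v hv => (ih v hv).2)
  refine (SimpleGraph.connected_iff_exists_forall_reachable _).2 ⟨⟨r, hr⟩, ?_⟩
  rintro ⟨v, hv⟩
  exact (hmem v (hreach v hv)).2.2

theorem herschel_adj_of_mem_herschelEdges (a b : Fin 11) (h : (a, b) ∈ herschelEdges) :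
    Herschel.Adj a b := by
  have hne : ∀ e ∈ herschelEdges, e.1 ≠ e.2 := by simp [herschelEdges]
  exact ⟨hne _ h, Or.inl h⟩

theorem exists_extendReached_herschelEdges_empty :
    ∃ r, r ∉ (∅ : Finset (Fin 11)) ∧ ∀ v, v ∉ (∅ : Finset (Fin 11)) →
      v ∈ (extendReached ∅ herschelEdges)^[3] [r] := by
  decide +kernel

theorem exists_extendReached_herschelEdges_pair (a b : Fin 11) :
    ∃ r, r ∉ ({a, b} : Finset (Fin 11)) ∧ ∀ v, v ∉ ({a, b} : Finset (Fin 11)) →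
      v ∈ (extendReached {a, b} herschelEdges)^[3] [r] := by
  decide +revert +kernel

theorem herschel_threeConnected : ThreeConnected Herschel := by
  refine ⟨by simp, fun S hS =>
    connected_induce_compl_of_extendReached Herschel herschel_adj_of_mem_herschelEdges 3 ?_⟩
  have hcard : S.card = 0 ∨ S.card = 1 ∨ S.card = 2 := by omega
  obtain h | h | h := hcard
  · obtain rfl := Finset.card_eq_zero.1 h
    exact exists_extendReached_herschelEdges_empty
  · obtain ⟨a, rfl⟩ := Finset.card_eq_one.1 h
    simpa using exists_extendReached_herschelEdges_pair a a
  · obtain ⟨a, b, -, rfl⟩ := Finset.card_eq_two.1 h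
    exact exists_extendReached_herschelEdges_pair a b
end

section
/- The Herschel graph 𝔥 contains the complete bipartite graph K_{2,5} as a minor. -/
/-- `G` contains `K` as a minor: there are pairwise disjoint nonempty branch sets
`B w ⊆ V(G)`, each inducing a connected subgraph of `G`, such that every edge of `K`
is witnessed by an edge of `G` between the corresponding branch sets. -/
def HasMinor {V W : Type*} (G : SimpleGraph V) (K : SimpleGraph W) : Prop :=
  ∃ B : W → Set V,
    (∀ w, (B w).Nonempty) ∧
    (∀ w₁ w₂, w₁ ≠ w₂ → Disjoint (B w₁) (B w₂)) ∧
    (∀ w, (G.induce (B w)).Connected) ∧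
    (∀ w₁ w₂, K.Adj w₁ w₂ → ∃ u ∈ B w₁, ∃ v ∈ B w₂, G.Adj u v)

instance : DecidableRel Herschel.Adj :=
  fun a b => inferInstanceAs
    (Decidable (a ≠ b ∧ ((a, b) ∈ herschelEdges ∨ (b, a) ∈ herschelEdges)))

theorem SimpleGraph.induce_connected_of_forall_eq_or_adj {V : Type*} (G : SimpleGraph V)
    {s : Set V} {c : V} (hc : c ∈ s) (h : ∀ v ∈ s, c = v ∨ G.Adj c v) :
    (G.induce s).Connected := by
  refine (SimpleGraph.connected_iff_exists_forall_reachable _).2 ⟨⟨c, hc⟩, fun ⟨v, hv⟩ => ?_⟩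
  obtain rfl | hadj := h v hv
  · exact SimpleGraph.Reachable.refl _
  · exact SimpleGraph.Adj.reachable (SimpleGraph.induce_adj.2 hadj)

/-- Branch sets of a `K_{2,5}` minor in the Herschel graph. -/
def herschelBranch : Fin 2 ⊕ Fin 5 → Finset (Fin 11)
  | .inl i => ![{2, 5}, {4, 6}] i
  | .inr j => ![{0}, {3}, {7}, {10}, {1, 8, 9}] j

theorem herschelBranch_star :
    ∀ w, ∃ c ∈ herschelBranch w, ∀ v ∈ herschelBranch w, c = v ∨ Herschel.Adj c v := by
  decide

theorem herschelBranch_disjoint :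
    ∀ w₁ w₂, w₁ ≠ w₂ → Disjoint (herschelBranch w₁) (herschelBranch w₂) := by
  decide

theorem herschelBranch_adj : ∀ i j, ∃ u ∈ herschelBranch (.inl i),
    ∃ v ∈ herschelBranch (.inr j), Herschel.Adj u v := by
  decide

theorem herschel_hasMinor_K25 :
    HasMinor Herschel (completeBipartiteGraph (Fin 2) (Fin 5)) := by
  refine ⟨fun w => herschelBranch w, fun w => ?_, fun w₁ w₂ h => ?_, fun w => ?_, ?_⟩
  · obtain ⟨c, hc, -⟩ := herschelBranch_star w
    exact ⟨c, hc⟩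
  · exact Finset.disjoint_coe.2 (herschelBranch_disjoint w₁ w₂ h)
  · obtain ⟨c, hc, h⟩ := herschelBranch_star w
    exact Herschel.induce_connected_of_forall_eq_or_adj hc h
  · rintro (i | i) (j | j) h
    · simp at h
    · exact herschelBranch_adj i j
    · obtain ⟨u, hu, v, hv, huv⟩ := herschelBranch_adj j i
      exact ⟨v, hv, u, hu, huv.symm⟩
    · simp at h
end

section
/- The Herschel graph 𝔥 does not contain the complete bipartite graph K_{2,6} as a minor. -/
/-- A connected vertex set with at most two elements is a vertex or an edge. -/
theorem SimpleGraph.Connected.eq_pair_of_ncard_le_two {V : Type*} {G : SimpleGraph V} {S : Set V}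
    (hS : (G.induce S).Connected) (hfin : S.Finite) (hcard : S.ncard ≤ 2) :
    ∃ a b, (a = b ∨ G.Adj a b) ∧ S = {a, b} := by
  obtain ⟨⟨a, ha⟩⟩ := hS.nonempty
  by_cases hsub : S = {a}
  · exact ⟨a, a, Or.inl rfl, by simpa using hsub⟩
  · obtain ⟨b, hb, hba⟩ : ∃ b ∈ S, b ≠ a := by
      by_contra! h
      exact hsub (Set.eq_singleton_iff_unique_mem.2 ⟨ha, h⟩)
    have hpair : S = {a, b} := by
      refine (Set.eq_of_subset_of_ncard_le ?_ ?_ hfin).symm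
      · rintro x (rfl | rfl) <;> assumption
      · rwa [Set.ncard_pair hba.symm]
    refine ⟨a, b, Or.inr ?_, hpair⟩
    obtain ⟨p⟩ := hS.preconnected ⟨a, ha⟩ ⟨b, hb⟩
    cases p with
    | nil => exact absurd rfl hba
    | @cons _ c _ hadj _ =>
      have hac : G.Adj a c := hadj
      have hc : (c : V) = a ∨ (c : V) = b := hpair.subset c.2
      rcases hc with hc | hc
      · exact absurd hc hac.ne'
      · rwa [hc] at hac

instance inst_s3 : DecidableRel Herschel.Adj := fun a b =>
  decidable_of_iff (a ≠ b ∧ ((a, b) ∈ herschelEdges ∨ (b, a) ∈ herschelEdges)) Iff.rfl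

theorem Herschel.card_neighbors_pair_le_five : ∀ a b : Fin 11, (a = b ∨ Herschel.Adj a b) →
    (Finset.univ.filter fun x => x ≠ a ∧ x ≠ b ∧ (Herschel.Adj a x ∨ Herschel.Adj b x)).card
      ≤ 5 := by
  decide +kernel

/-- A connected set touching six pairwise disjoint sets that avoid it has at least three
vertices. -/
theorem Herschel.three_le_ncard {S : Set (Fin 11)} (hS : (Herschel.induce S).Connected)
    {T : Fin 6 → Set (Fin 11)} (hST : ∀ i, Disjoint S (T i))
    (hT : ∀ i j, i ≠ j → Disjoint (T i) (T j))
    (hadj : ∀ i, ∃ u ∈ S, ∃ v ∈ T i, Herschel.Adj u v) : 3 ≤ S.ncard := by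
  by_contra! hlt
  obtain ⟨a, b, hab, rfl⟩ := hS.eq_pair_of_ncard_le_two S.toFinite (by omega)
  choose u hu v hv huv using hadj
  have hinj : Function.Injective v := fun i j hij => by
    by_contra hne
    exact Set.disjoint_left.1 (hT i j hne) (hv i) (hij ▸ hv j)
  have hle := Finset.card_le_card_of_injOn (s := Finset.univ)
    (t := Finset.univ.filter fun x =>
      x ≠ a ∧ x ≠ b ∧ (Herschel.Adj a x ∨ Herschel.Adj b x)) v (fun i _ => by
        have hnot : v i ∉ ({a, b} : Set (Fin 11)) := Set.disjoint_right.1 (hST i) (hv i)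
        have hui := hu i
        have huvi := huv i
        simp only [Set.mem_insert_iff, Set.mem_singleton_iff, not_or] at hnot hui
        simp only [Finset.coe_filter, Finset.mem_univ, true_and, Set.mem_ofPred_eq]
        refine ⟨hnot.1, hnot.2, ?_⟩
        rcases hui with h | h <;> rw [h] at huvi
        · exact Or.inl huvi
        · exact Or.inr huvi) hinj.injOn
  have := Herschel.card_neighbors_pair_le_five a b hab
  simp only [Finset.card_univ, Fintype.card_fin] at hle
  omega

theorem herschel_no_K26_minor :
    ¬ HasMinor Herschel (completeBipartiteGraph (Fin 2) (Fin 6)) := by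
  classical
  rintro ⟨B, hne, hdisj, hconn, hadj⟩
  have hhub : ∀ i : Fin 2, 3 ≤ (B (Sum.inl i)).ncard := fun i =>
    Herschel.three_le_ncard (hconn _) (T := fun j => B (Sum.inr j))
      (fun j => hdisj _ _ (by simp)) (fun j k hjk => hdisj _ _ (by simpa using hjk))
      (fun j => hadj _ _ (by simp))
  have hleaf : ∀ j : Fin 6, 1 ≤ (B (Sum.inr j)).ncard := fun j =>
    (Set.ncard_pos (Set.toFinite _)).2 (hne _)
  have hsum : ∑ w, (B w).ncard ≤ 11 := by
    have hcard := Finset.card_biUnion (s := Finset.univ) (t := fun w => (B w).toFinset)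
      (fun w _ w' _ h => Set.disjoint_toFinset.2 (hdisj w w' h))
    simp only [Set.ncard_eq_toFinset_card']
    rw [← hcard]
    exact (Finset.card_le_univ _).trans (by simp)
  have h₁ := Finset.sum_le_sum fun i (_ : i ∈ Finset.univ) => hhub i
  have h₂ := Finset.sum_le_sum fun j (_ : j ∈ Finset.univ) => hleaf j
  rw [Fintype.sum_sum_type] at hsum
  simp only [Finset.sum_const, Finset.card_univ, Fintype.card_fin, smul_eq_mul] at h₁ h₂
  omega
end

section
/- For every integer n ≥ 11, the graph G_n^• is not hamiltonian. -/
/-- Labels in `Fin 10`: `0 = h¹`, `1 = h²`, `2 = h₁`, `3 = h₂`, `4 = h₃`,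
`5 = h₁¹`, `6 = h₂¹`, `7 = h₃¹`, `8 = h₁²`, `9 = h₂²`.  The edges among these
vertices, including the five dashed edges `h₁h₂, h₂h₃, h₃h₁, h₁h², h₃h²`. -/
def bulletBase : List (Fin 10 × Fin 10) :=
  [(0,5),(0,6),(0,7),(1,8),(1,9),
   (2,5),(2,8),(2,7),
   (3,5),(3,8),(3,6),(3,9),
   (4,6),(4,9),(4,7),
   (2,3),(3,4),(4,2),(2,1),(4,1)]

/-- The graph `G_n^•` for `n ≥ 11`.  The vertex `Sum.inr k` is `v_{k+1}`,
for `0 ≤ k ≤ n - 11`, so that `v₁ = Sum.inr 0` and `v_{n-10} = Sum.inr (n-11)`. -/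
def GBullet (n : ℕ) : SimpleGraph (Fin 10 ⊕ Fin (n - 10)) :=
  SimpleGraph.fromRel (fun a b =>
    match a, b with
    | Sum.inl i, Sum.inl j => (i, j) ∈ bulletBase
    | Sum.inl i, Sum.inr k =>
        (i = 2 ∧ (k : ℕ) = 0) ∨ (i = 4 ∧ (k : ℕ) = n - 11) ∨ i = 1
    | Sum.inr _, Sum.inl _ => False
    | Sum.inr k, Sum.inr l => (l : ℕ) = (k : ℕ) + 1)

namespace SimpleGraph

/-- Hamiltonian graphs are tough: if `c` is locally constant on the graph left after deleting a
nonempty vertex set `S`, then `c` takes at most `#S` values there. -/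
theorem IsHamiltonian.card_le_of_locally_constant {V κ : Type*} [Fintype V] [DecidableEq V]
    [Nontrivial V] [Fintype κ] {G : SimpleGraph V} (hG : G.IsHamiltonian) {S : Finset V}
    (hS : S.Nonempty) (c : V → κ) (hsurj : ∀ k, ∃ w ∉ S, c w = k)
    (hc : ∀ v w, v ∉ S → w ∉ S → G.Adj v w → c v = c w) :
    Fintype.card κ ≤ S.card := by
  obtain ⟨u, hu⟩ := hS
  obtain ⟨p, hp⟩ := hG.exists_isHamiltonianCycle u
  have exits (k : κ) : ∃ d ∈ p.darts, c d.fst = k ∧ d.snd ∈ S := by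
    obtain ⟨w, hw, rfl⟩ := hsurj k
    obtain ⟨d, hd, ⟨hfst, hfstc⟩, hsnd⟩ :=
      (p.dropUntil w (hp.mem_support w)).exists_boundary_dart {v | v ∉ S ∧ c v = c w}
        ⟨hw, rfl⟩ (fun h => h.1 hu)
    refine ⟨d, p.darts_dropUntil_subset_darts _ hd, hfstc, ?_⟩
    by_contra h
    exact hsnd ⟨h, (hc _ _ hfst h d.adj).symm.trans hfstc⟩
  choose d hd hfst hsnd using exits
  have hnodup : (p.darts.map (·.snd)).Nodup := by
    rw [Walk.map_snd_darts]
    exact hp.support_nodup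
  have hinj : Function.Injective fun k => (d k).snd := fun k l hkl => by
    rw [← hfst k, ← hfst l, List.inj_on_of_nodup_map hnodup (hd k) (hd l) hkl]
  simpa using Finset.card_le_card_of_injOn (s := Finset.univ) _ (fun k _ => hsnd k)
    hinj.injOn

end SimpleGraph

theorem gBullet_not_hamiltonian (n : ℕ) (hn : 11 ≤ n) :
    ¬ (GBullet n).IsHamiltonian := by
  intro hG
  have : Nontrivial (Fin 10 ⊕ Fin (n - 10)) := ⟨.inl 0, .inl 1, by simp⟩
  let c : Fin 10 ⊕ Fin (n - 10) → Fin 6 :=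
    Sum.elim ![0, 0, 0, 0, 0, 0, 1, 2, 3, 4] fun _ => 5
  let S : Finset (Fin 10 ⊕ Fin (n - 10)) :=
    ({0, 1, 2, 3, 4} : Finset (Fin 10)).map .inl
  have mem_S (i : Fin 10) : .inl i ∈ S ↔ i ∈ ({0, 1, 2, 3, 4} : Finset (Fin 10)) :=
    Finset.mem_map' _
  have inr_notMem_S (k : Fin (n - 10)) : .inr k ∉ S := by simp [S]
  have hcard := hG.card_le_of_locally_constant (S := S) ⟨.inl 0, by simp [mem_S]⟩ c ?_ ?_
  · simp [S] at hcard
  · intro k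
    by_cases hk : k = 5
    · exact ⟨.inr ⟨0, by omega⟩, inr_notMem_S _, hk.symm⟩
    · have h : ∀ k : Fin 6, k ≠ 5 → ∃ i ∉ ({0, 1, 2, 3, 4} : Finset (Fin 10)),
          (![0, 0, 0, 0, 0, 0, 1, 2, 3, 4] : Fin 10 → Fin 6) i = k := by decide
      obtain ⟨i, hi, hik⟩ := h k hk
      exact ⟨.inl i, by rwa [mem_S], hik⟩
  · have hbase : ∀ i ∉ ({0, 1, 2, 3, 4} : Finset (Fin 10)),
        ∀ j ∉ ({0, 1, 2, 3, 4} : Finset (Fin 10)), (i, j) ∉ bulletBase := by decide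
    rintro (i | k) (j | l) hv hw hadj
    · rw [mem_S] at hv hw
      rcases hadj with ⟨-, h | h⟩
      · exact absurd h (hbase i hv j hw)
      · exact absurd h (hbase j hw i hv)
    · rw [mem_S] at hv
      rcases hadj with ⟨-, h | h⟩
      · rcases h with h | h | h <;> simp [h] at hv
      · exact h.elim
    · rw [mem_S] at hw
      rcases hadj with ⟨-, h | h⟩
      · exact h.elim
      · rcases h with h | h | h <;> simp [h] at hw
    · rfl
end

section
/- For every integer n ≥ 11, deleting the five vertices h₁, h₂, h₃, h¹, h² from the graph G_n^• leaves a graph with exactly six connected components. -/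
/-- A map that is constant on edges, surjective, and separates distinct components
identifies the connected components of a graph with its codomain. -/
theorem SimpleGraph.card_connectedComponent_eq_of_separating_map {V α : Type*} {G : SimpleGraph V}
    (f : V → α) (hf : Function.Surjective f) (hadj : ∀ a b, G.Adj a b → f a = f b)
    (hreach : ∀ a b, f a = f b → G.Reachable a b) :
    Nat.card G.ConnectedComponent = Nat.card α := by
  have hwalk : ∀ a b, ∀ p : G.Walk a b, f a = f b := by
    intro a b p
    induction p with
    | nil => rfl
    | cons h _ ih => exact (hadj _ _ h).trans ih
  refine Nat.card_eq_of_bijective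
    (SimpleGraph.ConnectedComponent.lift f fun a b p _ => hwalk a b p) ⟨?_, ?_⟩
  · intro c d
    induction c using SimpleGraph.ConnectedComponent.ind
    induction d using SimpleGraph.ConnectedComponent.ind
    intro h
    exact SimpleGraph.ConnectedComponent.sound (hreach _ _ h)
  · intro y
    obtain ⟨v, rfl⟩ := hf y
    exact ⟨G.connectedComponentMk v, rfl⟩

/-- Numbers the components left after the deletion: the vertices `5, …, 9` are isolated and
the path is the component `5`. -/
def bulletComponent {n : ℕ} : Fin 10 ⊕ Fin (n - 10) → Fin 6
  | Sum.inl i => Fin.ofNat 6 (i - 5)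
  | Sum.inr _ => 5

theorem gBullet_delete_five_vertices_six_components (n : ℕ) (hn : 11 ≤ n) :
    Nat.card ((GBullet n).induce
      ({Sum.inl 2, Sum.inl 3, Sum.inl 4, Sum.inl 0, Sum.inl 1}ᶜ :
        Set (Fin 10 ⊕ Fin (n - 10)))).ConnectedComponent = 6 := by
  set S : Set (Fin 10 ⊕ Fin (n - 10)) :=
    {Sum.inl 2, Sum.inl 3, Sum.inl 4, Sum.inl 0, Sum.inl 1}ᶜ with hS
  have hmem : ∀ i : Fin 10, (Sum.inl i : Fin 10 ⊕ Fin (n - 10)) ∈ S ↔ 5 ≤ i := by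
    intro i
    simp only [hS, Set.mem_compl_iff, Set.mem_insert_iff, Set.mem_singleton_iff, Sum.inl.injEq]
    revert i
    decide
  have hmem' : ∀ k : Fin (n - 10), (Sum.inr k : Fin 10 ⊕ Fin (n - 10)) ∈ S := by
    simp [hS]
  have hpath : ∀ (k : ℕ) (hk : k < n - 10), ((GBullet n).induce S).Reachable
      ⟨Sum.inr ⟨0, by omega⟩, hmem' _⟩ ⟨Sum.inr ⟨k, hk⟩, hmem' _⟩ := by
    intro k
    induction k with
    | zero => exact fun _ => SimpleGraph.Reachable.refl _
    | succ k ih =>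
      intro hk
      refine (ih (by omega)).trans (SimpleGraph.Adj.reachable ?_)
      simp [GBullet]
  rw [SimpleGraph.card_connectedComponent_eq_of_separating_map
    (fun v : S => bulletComponent v.1), Nat.card_fin]
  · intro c
    by_cases hc : c = 5
    · exact ⟨⟨Sum.inr ⟨0, by omega⟩, hmem' _⟩, hc.symm⟩
    · refine ⟨⟨Sum.inl (Fin.ofNat 10 (c + 5)), (hmem _).2 ?_⟩, ?_⟩
      · revert c
        decide
      · change Fin.ofNat 6 ((Fin.ofNat 10 (c + 5) : Fin 10) - 5) = c
        revert c
        decide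
  · rintro ⟨a | a, ha⟩ ⟨b | b, hb⟩ h
    · rw [hmem] at ha hb
      simp only [GBullet, SimpleGraph.comap_adj, Function.Embedding.subtype_apply,
        SimpleGraph.fromRel_adj] at h
      have key : ∀ a b : Fin 10, 5 ≤ a → 5 ≤ b → ¬((a, b) ∈ bulletBase ∨ (b, a) ∈ bulletBase) := by
        decide
      exact absurd h.2 (key a b ha hb)
    · rw [hmem] at ha
      simp [GBullet] at h
      omega
    · rw [hmem] at hb
      simp [GBullet] at h
      omega
    · rfl
  · have inj : ∀ a b : Fin 10, 5 ≤ a → 5 ≤ b →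
        Fin.ofNat 6 (a - 5) = Fin.ofNat 6 (b - 5) → a = b := by
      decide
    have ne : ∀ a : Fin 10, 5 ≤ a → Fin.ofNat 6 (a - 5) ≠ 5 := by
      decide
    rintro ⟨a | a, ha⟩ ⟨b | b, hb⟩ h
    · obtain rfl := inj a b ((hmem _).1 ha) ((hmem _).1 hb) h
      exact SimpleGraph.Reachable.refl _
    · exact absurd h (ne a ((hmem _).1 ha))
    · exact absurd h.symm (ne b ((hmem _).1 hb))
    · exact (hpath a a.2).symm.trans (hpath b b.2)
end

section
/- For every integer n ≥ 13, the graph G_n^∘ is not hamiltonian. -/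
/-- Labels in `Fin 12`: `0 = h¹`, `1 = h²`, `2 = h₁`, `3 = h₂`, `4 = h₃`,
`5 = h₁¹`, `6 = h₂¹`, `7 = h₃¹`, `8 = h₁²`, `9 = h₂²`, `10 = t₁`, `11 = t₂`.
The edges among these vertices, including the five dashed edges. -/
def circBase : List (Fin 12 × Fin 12) :=
  [(0,10),(10,5),(0,11),(11,6),(10,11),(0,7),
   (1,8),(1,9),
   (2,5),(2,8),(2,7),
   (3,5),(3,8),(3,6),(3,9),
   (4,6),(4,9),(4,7),
   (2,3),(3,4),(4,2),(2,1),(4,1)]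

/-- The graph `G_n^∘` for `n ≥ 13`.  The vertex `Sum.inr k` is `v_{k+1}`,
for `0 ≤ k ≤ n - 13`, so that `v₁ = Sum.inr 0` and `v_{n-12} = Sum.inr (n-13)`. -/
def GCirc (n : ℕ) : SimpleGraph (Fin 12 ⊕ Fin (n - 12)) :=
  SimpleGraph.fromRel (fun a b =>
    match a, b with
    | Sum.inl i, Sum.inl j => (i, j) ∈ circBase
    | Sum.inl i, Sum.inr k =>
        (i = 2 ∧ (k : ℕ) = 0) ∨ (i = 4 ∧ (k : ℕ) = n - 13) ∨ i = 1
    | Sum.inr _, Sum.inl _ => False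
    | Sum.inr k, Sum.inr l => (l : ℕ) = (k : ℕ) + 1)

namespace SimpleGraph.Walk.IsHamiltonianCycle

/-- The successor map along a Hamiltonian cycle. -/
theorem exists_perm_adj {V : Type*} [DecidableEq V] {G : SimpleGraph V} {a : V}
    {p : G.Walk a a} (hp : p.IsHamiltonianCycle) :
    ∃ σ : Equiv.Perm V, ∀ x, G.Adj x (σ x) ∧ σ (σ x) ≠ x := by
  have hlen : p.support.tail.length = p.length := by simp
  have hthree : 3 ≤ p.length := hp.isCycle.three_le_length
  have hnodup : p.support.tail.Nodup := hp.isCycle.support_nodup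
  have hget : ∀ i (hi : i < p.support.tail.length), p.support.tail[i] = p.getVert (i + 1) := by
    intro i hi
    rw [List.getElem_tail, support_getElem_eq_getVert]
  refine ⟨p.support.tail.formPerm, fun x => ?_⟩
  have hx : x ∈ p.support.tail := by
    have := (isHamiltonianCycle_iff_isCycle_and_support_count_tail_eq_one.1 hp).2 x
    exact List.count_pos_iff.1 (by omega)
  obtain ⟨i, hi, rfl⟩ := List.getElem_of_mem hx
  rw [List.formPerm_apply_getElem _ hnodup, List.formPerm_apply_getElem _ hnodup]
  constructor
  · rw [hget, hget]
    rcases Nat.lt_or_ge (i + 1) p.support.tail.length with h | h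
    · rw [Nat.mod_eq_of_lt h]
      exact p.adj_getVert_succ (by omega)
    · have h' : i + 1 = p.length := by omega
      rw [hlen, h', Nat.mod_self, getVert_length]
      simpa using p.adj_getVert_succ (i := 0) (by omega)
  · rw [Ne, hnodup.getElem_inj_iff, hlen]
    intro h
    rcases Nat.lt_or_ge (i + 1) p.length with h1 | h1
    · rw [Nat.mod_eq_of_lt h1] at h
      rcases Nat.lt_or_ge (i + 1 + 1) p.length with h2 | h2
      · rw [Nat.mod_eq_of_lt h2] at h; omega
      · rw [show i + 1 + 1 = p.length by omega, Nat.mod_self] at h; omega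
    · rw [show i + 1 = p.length by omega, Nat.mod_self, Nat.mod_eq_of_lt (by omega)] at h
      omega

end SimpleGraph.Walk.IsHamiltonianCycle

/-- The vertices `h²`, `h₁`, `h₂`, `h₃`. -/
def circHubs (n : ℕ) : Finset (Fin 12 ⊕ Fin (n - 12)) :=
  {Sum.inl 1, Sum.inl 2, Sum.inl 3, Sum.inl 4}

theorem GCirc_adj_inl_inl {n : ℕ} {i j : Fin 12} :
    (GCirc n).Adj (Sum.inl i) (Sum.inl j) ↔ i ≠ j ∧ ((i, j) ∈ circBase ∨ (j, i) ∈ circBase) := by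
  simp [GCirc]

theorem GCirc_adj_inr_inr {n : ℕ} {k l : Fin (n - 12)} :
    (GCirc n).Adj (Sum.inr k) (Sum.inr l) ↔ (l : ℕ) = k + 1 ∨ (k : ℕ) = l + 1 := by
  simp only [GCirc, SimpleGraph.fromRel_adj, ne_eq, Sum.inr.injEq, and_iff_right_iff_imp]
  rintro h rfl
  omega

theorem GCirc_mem_circHubs_of_adj_inr {n : ℕ} {k : Fin (n - 12)} {i : Fin 12}
    (h : (GCirc n).Adj (Sum.inr k) (Sum.inl i)) : (Sum.inl i) ∈ circHubs n := by
  simp only [GCirc, SimpleGraph.fromRel_adj] at h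
  rcases h.2 with h | ⟨rfl, -⟩ | ⟨rfl, -⟩ | rfl
  · exact h.elim
  all_goals simp [circHubs]

theorem GCirc_not_adj_inl_inr {n : ℕ} {k : Fin (n - 12)} {i : Fin 12}
    (hi : Sum.inl i ∉ circHubs n) : ¬ (GCirc n).Adj (Sum.inl i) (Sum.inr k) :=
  fun h => hi (GCirc_mem_circHubs_of_adj_inr h.symm)

/-- A map to neighbours without immediate backtracking leaves the path `v₁, …, v_{n-12}`. -/
theorem GCirc_exists_inr_map_mem_circHubs {n : ℕ} (hn : 13 ≤ n)
    {f : Fin 12 ⊕ Fin (n - 12) → Fin 12 ⊕ Fin (n - 12)}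
    (hadj : ∀ x, (GCirc n).Adj x (f x)) (hback : ∀ x, f (f x) ≠ x) :
    ∃ k, f (Sum.inr k) ∈ circHubs n := by
  by_contra! hout
  have hin : ∀ k, ∃ l, f (Sum.inr k) = Sum.inr l ∧ ((l : ℕ) = k + 1 ∨ (k : ℕ) = l + 1) := by
    intro k
    have h := hadj (Sum.inr k)
    have hk := hout k
    rcases hf : f (Sum.inr k) with i | l
    · rw [hf] at h hk
      exact (hk (GCirc_mem_circHubs_of_adj_inr h)).elim
    · rw [hf] at h
      exact ⟨l, rfl, GCirc_adj_inr_inr.1 h⟩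
  have hsucc : ∀ (m : ℕ) (hm : m < n - 12), ∃ l : Fin (n - 12),
      f (Sum.inr ⟨m, hm⟩) = Sum.inr l ∧ (l : ℕ) = m + 1 := by
    intro m
    induction m with
    | zero =>
      intro hm
      obtain ⟨l, hl, h | h⟩ := hin ⟨0, hm⟩
      · exact ⟨l, hl, h⟩
      · simp at h
    | succ m ih =>
      intro hm
      obtain ⟨l, hl, h | h⟩ := hin ⟨m + 1, hm⟩
      · exact ⟨l, hl, h⟩
      · obtain ⟨l', hl', h'⟩ := ih (by omega)
        have e : l' = ⟨m + 1, hm⟩ := Fin.ext h'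
        have e' : l = ⟨m, by omega⟩ := Fin.ext (by simpa using h.symm)
        rw [e] at hl'
        rw [e'] at hl
        exact (hback (Sum.inr ⟨m, by omega⟩) (by rw [hl', hl])).elim
  obtain ⟨l, -, hl⟩ := hsucc (n - 13) (by omega)
  have := l.2
  omega

/-- The vertices `h₁²` and `h₂²` have only hubs as neighbours. -/
theorem GCirc_mem_circHubs_of_adj {n : ℕ} {i : Fin 12} (hi : i = 8 ∨ i = 9)
    {y : Fin 12 ⊕ Fin (n - 12)} (h : (GCirc n).Adj (Sum.inl i) y) : y ∈ circHubs n := by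
  rcases y with j | k
  · rw [GCirc_adj_inl_inl] at h
    simp only [circHubs, Finset.mem_insert, Finset.mem_singleton, Sum.inl.injEq]
    revert h
    rcases hi with rfl | rfl <;> revert j <;> decide
  · exact (GCirc_not_adj_inl_inr (by rcases hi with rfl | rfl <;> simp [circHubs]) h).elim

/-- Each of `h₁¹`, `h₂¹`, `h₃¹` has at most one neighbour that is not a hub. -/
theorem GCirc_exists_eq_of_adj {n : ℕ} {i : Fin 12} (hi : i = 5 ∨ i = 6 ∨ i = 7) :
    ∃ c, ∀ y, (GCirc n).Adj (Sum.inl i) y → y ∉ circHubs n → y = c := by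
  have hub : Sum.inl i ∉ circHubs n := by rcases hi with rfl | rfl | rfl <;> simp [circHubs]
  have key : ∃ c : Fin 12, ∀ j, i ≠ j ∧ ((i, j) ∈ circBase ∨ (j, i) ∈ circBase) →
      ¬(j = 1 ∨ j = 2 ∨ j = 3 ∨ j = 4) → j = c := by
    rcases hi with rfl | rfl | rfl
    · exact ⟨10, by decide⟩
    · exact ⟨11, by decide⟩
    · exact ⟨0, by decide⟩
  obtain ⟨c, hc⟩ := key
  refine ⟨Sum.inl c, ?_⟩
  rintro (j | k) hy hy'
  · rw [hc j (GCirc_adj_inl_inl.1 hy) (by simpa [circHubs] using hy')]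
  · exact (GCirc_not_adj_inl_inr hub hy).elim

/-- An injective map to neighbours without immediate backtracking sends `h₁²`, `h₂²` and some `v_k`
to hubs, so it sends at most one further vertex there. -/
theorem GCirc_not_map_mem_circHubs {n : ℕ} (hn : 13 ≤ n)
    {f : Fin 12 ⊕ Fin (n - 12) → Fin 12 ⊕ Fin (n - 12)} (hf : f.Injective)
    (hadj : ∀ x, (GCirc n).Adj x (f x)) (hback : ∀ x, f (f x) ≠ x) {i j : Fin 12} (hij : i ≠ j)
    (hi : i ≠ 8 ∧ i ≠ 9) (hj : j ≠ 8 ∧ j ≠ 9) (hfi : f (Sum.inl i) ∈ circHubs n) :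
    f (Sum.inl j) ∉ circHubs n := by
  intro hfj
  obtain ⟨k, hk⟩ := GCirc_exists_inr_map_mem_circHubs hn hadj hback
  let s : Finset (Fin 12 ⊕ Fin (n - 12)) :=
    {Sum.inr k, Sum.inl i, Sum.inl j, Sum.inl 8, Sum.inl 9}
  have hs : s.card = 5 := by
    simp [s, hij, hi, hj]
  have hmaps : Set.MapsTo f s (circHubs n) := by
    intro x hx
    simp only [s, Finset.coe_insert, Finset.coe_singleton, Set.mem_insert_iff,
      Set.mem_singleton_iff] at hx
    rcases hx with rfl | rfl | rfl | rfl | rfl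
    · exact hk
    · exact hfi
    · exact hfj
    · exact GCirc_mem_circHubs_of_adj (Or.inl rfl) (hadj _)
    · exact GCirc_mem_circHubs_of_adj (Or.inr rfl) (hadj _)
  have hle := Finset.card_le_card_of_injOn f hmaps hf.injOn
  have hhubs : (circHubs n).card ≤ 4 := Finset.card_le_four
  omega

theorem gCirc_not_hamiltonian (n : ℕ) (hn : 13 ≤ n) :
    ¬ (GCirc n).IsHamiltonian := by
  intro h
  obtain ⟨a, p, hp⟩ := h (by simp; omega)
  obtain ⟨σ, hσ⟩ := hp.exists_perm_adj
  have hadj : ∀ x, (GCirc n).Adj x (σ.symm x) := fun x => by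
    simpa using (hσ (σ.symm x)).1.symm
  have hback : ∀ x, σ.symm (σ.symm x) ≠ x := fun x hx =>
    (hσ x).2 (by rw [← Equiv.eq_symm_apply, ← Equiv.eq_symm_apply, hx])
  have hone : ∀ i : Fin 12, (i = 5 ∨ i = 6 ∨ i = 7) →
      σ (Sum.inl i) ∈ circHubs n ∨ σ.symm (Sum.inl i) ∈ circHubs n := by
    intro i hi
    obtain ⟨c, hc⟩ := GCirc_exists_eq_of_adj (n := n) hi
    by_contra! hout
    have he := (hc _ (hσ _).1 hout.1).trans (hc _ (hadj _) hout.2).symm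
    exact (hσ (Sum.inl i)).2 (by rw [he, Equiv.apply_symm_apply])
  have hfwd := fun (i j : Fin 12) => GCirc_not_map_mem_circHubs (i := i) (j := j) hn σ.injective
    (fun x => (hσ x).1) (fun x => (hσ x).2)
  have hbwd := fun (i j : Fin 12) =>
    GCirc_not_map_mem_circHubs (i := i) (j := j) hn σ.symm.injective hadj hback
  have f56 := hfwd 5 6 (by decide) (by decide) (by decide)
  have f57 := hfwd 5 7 (by decide) (by decide) (by decide)
  have f67 := hfwd 6 7 (by decide) (by decide) (by decide)
  have b56 := hbwd 5 6 (by decide) (by decide) (by decide)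
  have b57 := hbwd 5 7 (by decide) (by decide) (by decide)
  have b67 := hbwd 6 7 (by decide) (by decide) (by decide)
  rcases hone 5 (by decide) with h5 | h5 <;> rcases hone 6 (by decide) with h6 | h6 <;>
    rcases hone 7 (by decide) with h7 | h7
  · exact f56 h5 h6
  · exact f56 h5 h6
  · exact f57 h5 h7
  · exact b67 h6 h7
  · exact f67 h6 h7
  · exact b57 h5 h7
  · exact b56 h5 h6
  · exact b56 h5 h6
end

section
/- For every integer n ≥ 11, the graph G_n^• is hamiltonian if and only if the graph G_{n+2}^∘ is hamiltonian. -/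
namespace SimpleGraph

/-- A hamiltonian graph on at least two vertices has a permutation of its vertices that follows
edges and consists of a single cycle. -/
theorem IsHamiltonian.exists_perm {V : Type*} [Fintype V] [DecidableEq V] {G : SimpleGraph V}
    (hG : G.IsHamiltonian) (hV : Fintype.card V ≠ 1) :
    ∃ σ : Equiv.Perm V, (∀ v, G.Adj v (σ v)) ∧ σ.IsCycleOn Set.univ := by
  obtain ⟨a, p, hp⟩ := hG hV
  have hlen : p.support.tail.length = p.length := by simp
  have hmem : ∀ v, v ∈ p.support.tail := fun v ↦
    List.count_pos_iff.1 (by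
      simp [(Walk.isHamiltonianCycle_iff_isCycle_and_support_count_tail_eq_one.1 hp).2 v])
  refine ⟨p.support.tail.formPerm, fun v ↦ ?_, ?_⟩
  · obtain ⟨i, hi, rfl⟩ := List.getElem_of_mem (hmem v)
    rw [List.formPerm_apply_getElem _ hp.isCycle.support_nodup]
    have hget : ∀ (j : ℕ) (hj : j < p.support.tail.length),
        p.support.tail[j] = p.getVert (j + 1) := fun j hj ↦ by
      rw [List.getElem_tail, Walk.support_getElem_eq_getVert]
    rw [hget, hget]
    rcases Nat.lt_or_ge (i + 1) p.support.tail.length with h | h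
    · rw [Nat.mod_eq_of_lt h]
      exact p.adj_getVert_succ (by omega)
    · have hi' : i + 1 = p.length := by omega
      have h0 := p.adj_getVert_succ (i := 0) (by omega)
      rw [hlen, hi', Nat.mod_self, Walk.getVert_length]
      rwa [Walk.getVert_zero] at h0
  · have h := hp.isCycle.support_nodup.isCycleOn_formPerm
    rwa [Set.eq_univ_of_forall (s := {v | v ∈ p.support.tail}) hmem] at h

end SimpleGraph

/-- A permutation consisting of a single cycle leaves every proper nonempty set. -/
theorem exists_mem_apply_notMem_of_isCycleOn_univ {V : Type*} [Finite V] {σ : Equiv.Perm V}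
    (hσ : σ.IsCycleOn _root_.Set.univ) {s : Set V} {v w : V} (hv : v ∈ s) (hw : w ∉ s) :
    ∃ x ∈ s, σ x ∉ s := by
  by_contra! h
  obtain ⟨k, -, rfl⟩ := (hσ.2 (Set.mem_univ v) (Set.mem_univ w)).exists_pow_eq'
  refine hw ?_
  clear hw
  induction k with
  | zero => simpa
  | succ k ih => rw [pow_succ']; exact h _ ih

/-- A permutation consisting of a single cycle on at least three points has no two-point orbit. -/
theorem apply_apply_ne_of_isCycleOn_univ {V : Type*} [Finite V] {σ : Equiv.Perm V}
    (hσ : σ.IsCycleOn _root_.Set.univ) {v w : V} (hv : w ≠ v) (hw : w ≠ σ v) : σ (σ v) ≠ v := by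
  intro h
  obtain ⟨x, hx, hx'⟩ := exists_mem_apply_notMem_of_isCycleOn_univ hσ (s := {v, σ v}) (v := v)
    (w := w) (by simp) (by simp [hv, hw])
  rcases hx with rfl | rfl <;> simp [h] at hx'

theorem GBullet.adj_inl {n : ℕ} {i : Fin 10} {w : Fin 10 ⊕ Fin (n - 10)}
    (h : (GBullet n).Adj (.inl i) w) :
    (∃ j, w = .inl j ∧ ((i, j) ∈ bulletBase ∨ (j, i) ∈ bulletBase)) ∨ i = 1 ∨ i = 2 ∨ i = 4 := by
  rcases w with j | k
  · exact .inl ⟨j, rfl, by simpa [GBullet] using h.2⟩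
  · simp [GBullet] at h
    tauto

theorem GBullet.adj_inr_inl {n : ℕ} {i : Fin 10} {k : Fin (n - 10)}
    (h : (GBullet n).Adj (.inr k) (.inl i)) : i = 1 ∨ i = 2 ∨ i = 4 := by
  simp [GBullet] at h
  tauto

theorem GCirc.adj_inl {n : ℕ} {i : Fin 12} {w : Fin 12 ⊕ Fin (n - 12)}
    (h : (GCirc n).Adj (.inl i) w) :
    (∃ j, w = .inl j ∧ ((i, j) ∈ circBase ∨ (j, i) ∈ circBase)) ∨ i = 1 ∨ i = 2 ∨ i = 4 := by
  rcases w with j | k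
  · exact .inl ⟨j, rfl, by simpa [GCirc] using h.2⟩
  · simp [GCirc] at h
    tauto

theorem GCirc.adj_inr_inl {n : ℕ} {i : Fin 12} {k : Fin (n - 12)}
    (h : (GCirc n).Adj (.inr k) (.inl i)) : i = 1 ∨ i = 2 ∨ i = 4 := by
  simp [GCirc] at h
  tauto

/-- The six parts `{h₁¹}`, `{h₂¹}`, `{h₃¹}`, `{h₁²}`, `{h₂²}`, `{v₁, …}` are joined to the rest of
`G_n^•` only through the five vertices `h¹, h², h₁, h₂, h₃`. -/
theorem GBullet.not_isHamiltonian {n : ℕ} (hn : 11 ≤ n) : ¬ (GBullet n).IsHamiltonian := by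
  intro hG
  obtain ⟨σ, hadj, hσ⟩ := hG.exists_perm (by simp; omega)
  obtain ⟨_, ⟨k, rfl⟩, hk⟩ := exists_mem_apply_notMem_of_isCycleOn_univ hσ
    (s := Set.range Sum.inr) (v := .inr ⟨0, by omega⟩) (w := .inl 0) (by simp) (by simp)
  have hv : ∃ i, σ (.inr k) = .inl i ∧ (i = 1 ∨ i = 2 ∨ i = 4) := by
    have := hadj (.inr k)
    generalize σ (.inr k) = w at this hk
    rcases w with i | j
    · exact ⟨i, rfl, adj_inr_inl this⟩
    · simp at hk
  have key (i : Fin 10) (hi : ¬ (i = 1 ∨ i = 2 ∨ i = 4)) :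
      ∃ j, σ (.inl i) = .inl j ∧ ((i, j) ∈ bulletBase ∨ (j, i) ∈ bulletBase) :=
    (adj_inl (hadj (.inl i))).resolve_right hi
  have exits (i : Fin 10) (hi : 5 ≤ i) : ∃ j < 5, σ (.inl i) = .inl j := by
    obtain ⟨j, hj, h⟩ := key i (by omega)
    refine ⟨j, ?_, hj⟩
    clear hj
    revert i j
    decide
  have hcard : (insert (.inr k) ((Finset.Ici 5).image .inl) : Finset (Fin 10 ⊕ Fin (n - 10))).card
      ≤ ((Finset.Iio 5).image .inl : Finset (Fin 10 ⊕ Fin (n - 10))).card := by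
    refine Finset.card_le_card_of_injOn σ (fun x hx ↦ ?_) σ.injective.injOn
    rw [Finset.mem_coe, Finset.mem_insert, Finset.mem_image] at hx
    rw [Finset.mem_coe, Finset.mem_image]
    obtain rfl | ⟨i, hi, rfl⟩ := hx
    · obtain ⟨i, h, hi⟩ := hv
      exact ⟨i, by clear h; revert i; decide, h.symm⟩
    · obtain ⟨j, hj, h⟩ := exits i (Finset.mem_Ici.1 hi)
      exact ⟨j, Finset.mem_Iio.2 hj, h.symm⟩
  rw [Finset.card_insert_of_notMem (by simp), Finset.card_image_of_injective _ Sum.inl_injective,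
    Finset.card_image_of_injective _ Sum.inl_injective] at hcard
  exact absurd hcard (by decide)

/-- The six parts `{h₁¹}`, `{h₂¹}`, `{h₃¹}`, `{h₁²}`, `{h₂²}`, `{v₁, …}` are joined to the rest of
`G_n^∘` only through `h², h₁, h₂, h₃` and the triangle `h¹, t₁, t₂`.  The triangle is left by only
three edges, so a hamiltonian cycle enters it just once. -/
theorem GCirc.not_isHamiltonian {n : ℕ} (hn : 13 ≤ n) : ¬ (GCirc n).IsHamiltonian := by
  intro hG
  obtain ⟨σ, hadj, hσ⟩ := hG.exists_perm (by simp; omega)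
  obtain ⟨_, ⟨k, rfl⟩, hk⟩ := exists_mem_apply_notMem_of_isCycleOn_univ hσ
    (s := Set.range Sum.inr) (v := .inr ⟨0, by omega⟩) (w := .inl 0) (by simp) (by simp)
  have hv : ∃ i, σ (.inr k) = .inl i ∧ (i = 1 ∨ i = 2 ∨ i = 4) := by
    have := hadj (.inr k)
    generalize σ (.inr k) = w at this hk
    rcases w with i | j
    · exact ⟨i, rfl, adj_inr_inl this⟩
    · simp at hk
  have key (i : Fin 12) (hi : ¬ (i = 1 ∨ i = 2 ∨ i = 4)) :
      ∃ j, σ (.inl i) = .inl j ∧ ((i, j) ∈ circBase ∨ (j, i) ∈ circBase) :=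
    (adj_inl (hadj (.inl i))).resolve_right hi
  have two {i j : Fin 12} (h : σ (.inl i) = .inl j) : σ (.inl j) ≠ .inl i := by
    rw [← h]
    exact apply_apply_ne_of_isCycleOn_univ hσ (w := .inr ⟨0, by omega⟩) (by simp) (by simp [h])
  have inj {i j l : Fin 12} (hi : σ (.inl i) = .inl l) (hj : σ (.inl j) = .inl l) : i = j :=
    Sum.inl_injective (σ.injective (hi.trans hj.symm))
  have h0 : σ (.inl 0) = .inl 10 ∨ σ (.inl 0) = .inl 11 ∨ σ (.inl 0) = .inl 7 := by
    obtain ⟨j, h, hj⟩ := key 0 (by decide)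
    rw [h]
    clear h
    revert j
    simp only [Sum.inl.injEq]
    decide
  have h10 : σ (.inl 10) = .inl 0 ∨ σ (.inl 10) = .inl 11 ∨ σ (.inl 10) = .inl 5 := by
    obtain ⟨j, h, hj⟩ := key 10 (by decide)
    rw [h]
    clear h
    revert j
    simp only [Sum.inl.injEq]
    decide
  have h11 : σ (.inl 11) = .inl 0 ∨ σ (.inl 11) = .inl 10 ∨ σ (.inl 11) = .inl 6 := by
    obtain ⟨j, h, hj⟩ := key 11 (by decide)
    rw [h]
    clear h
    revert j
    simp only [Sum.inl.injEq]
    decide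
  have h56 : σ (.inl 5) = .inl 10 → σ (.inl 6) ≠ .inl 11 := fun h h' ↦ by
    have h₁ := h10.resolve_right (not_or.2 ⟨fun e ↦ absurd (inj e h') (by decide), two h⟩)
    have h₂ := h11.resolve_right (not_or.2 ⟨fun e ↦ absurd (inj e h) (by decide), two h'⟩)
    exact absurd (inj h₁ h₂) (by decide)
  have h57 : σ (.inl 5) = .inl 10 → σ (.inl 7) ≠ .inl 0 := fun h h' ↦ by
    have h₁ := (h10.resolve_left fun e ↦ absurd (inj e h') (by decide)).resolve_right (two h)
    have h₂ := (h0.resolve_left fun e ↦ absurd (inj e h) (by decide)).resolve_right (two h')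
    exact absurd (inj h₁ h₂) (by decide)
  have h67 : σ (.inl 6) = .inl 11 → σ (.inl 7) ≠ .inl 0 := fun h h' ↦ by
    have h₁ := (h11.resolve_left fun e ↦ absurd (inj e h') (by decide)).resolve_right (two h)
    have h₂ := h0.resolve_right (not_or.2 ⟨fun e ↦ absurd (inj e h) (by decide), two h'⟩)
    exact absurd (inj h₁ h₂) (by decide)
  have exits (i : Fin 12) (hi : i ∈ Finset.Icc 5 9) : (∃ j ∈ Finset.Icc 1 4, σ (.inl i) = .inl j) ∨
      i = 5 ∧ σ (.inl 5) = .inl 10 ∨ i = 6 ∧ σ (.inl 6) = .inl 11 ∨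
      i = 7 ∧ σ (.inl 7) = .inl 0 := by
    obtain ⟨j, hj, h⟩ := key i (by revert i; decide)
    have : j ∈ Finset.Icc 1 4 ∨ i = 5 ∧ j = 10 ∨ i = 6 ∧ j = 11 ∨ i = 7 ∧ j = 0 := by
      clear hj
      revert i j
      decide
    rcases this with h | ⟨rfl, rfl⟩ | ⟨rfl, rfl⟩ | ⟨rfl, rfl⟩
    · exact .inl ⟨j, h, hj⟩
    all_goals simp [hj]
  obtain ⟨x, hx, hexits⟩ : ∃ x ∈ Finset.Icc (5 : Fin 12) 9, ∀ i ∈ (Finset.Icc 5 9).erase x,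
      ∃ j ∈ Finset.Icc 1 4, σ (.inl i) = .inl j := by
    by_cases h5 : σ (.inl 5) = .inl 10
    · exact ⟨5, by decide, by grind⟩
    by_cases h6 : σ (.inl 6) = .inl 11
    · exact ⟨6, by decide, by grind⟩
    · exact ⟨7, by decide, by grind⟩
  have hcard : (insert (.inr k) (((Finset.Icc 5 9).erase x).image .inl) :
      Finset (Fin 12 ⊕ Fin (n - 12))).card
      ≤ ((Finset.Icc 1 4).image .inl : Finset (Fin 12 ⊕ Fin (n - 12))).card := by
    refine Finset.card_le_card_of_injOn σ (fun y hy ↦ ?_) σ.injective.injOn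
    rw [Finset.mem_coe, Finset.mem_insert, Finset.mem_image] at hy
    rw [Finset.mem_coe, Finset.mem_image]
    obtain rfl | ⟨i, hi, rfl⟩ := hy
    · obtain ⟨i, h, hi⟩ := hv
      exact ⟨i, by clear h; revert i; decide, h.symm⟩
    · obtain ⟨j, hj, h⟩ := hexits i hi
      exact ⟨j, hj, h.symm⟩
  rw [Finset.card_insert_of_notMem (by simp), Finset.card_image_of_injective _ Sum.inl_injective,
    Finset.card_image_of_injective _ Sum.inl_injective, Finset.card_erase_of_mem hx] at hcard
  exact absurd hcard (by decide)

theorem gBullet_hamiltonian_iff_gCirc_hamiltonian (n : ℕ) (hn : 11 ≤ n) :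
    (GBullet n).IsHamiltonian ↔ (GCirc (n + 2)).IsHamiltonian :=
  iff_of_false (GBullet.not_isHamiltonian hn) (GCirc.not_isHamiltonian (by omega))
end

section
/- For every integer n ≥ 11, the graph G_{n+2}^∘ contains the graph G_n^• as a minor. -/
/-- If the fibres of `f` are stars in `G` centred at the values of a section `s` of `f`, and every
edge of `K` lifts to an edge of `G`, then contracting the fibres of `f` exhibits `K` as a minor. -/
theorem HasMinor.of_star_fibers {V W : Type*} {G : SimpleGraph V} {K : SimpleGraph W}
    (f : V → W) (s : W → V) (hs : ∀ w, f (s w) = w)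
    (hstar : ∀ v, v = s (f v) ∨ G.Adj v (s (f v)))
    (hedge : ∀ w₁ w₂, K.Adj w₁ w₂ → ∃ u v, f u = w₁ ∧ f v = w₂ ∧ G.Adj u v) :
    HasMinor G K := by
  refine ⟨fun w => f ⁻¹' {w}, fun w => ⟨s w, hs w⟩, fun w₁ w₂ hne => ?_, fun w => ?_,
    fun w₁ w₂ h => ?_⟩
  · rw [Set.disjoint_left]
    exact fun v h₁ h₂ => hne (h₁.symm.trans h₂)
  · have reach (v : f ⁻¹' {w}) : (G.induce (f ⁻¹' {w})).Reachable v ⟨s w, hs w⟩ := by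
      obtain ⟨v, rfl⟩ := v
      rcases hstar v with h | h
      · exact (Subtype.ext h : (⟨v, rfl⟩ : f ⁻¹' {f v}) = ⟨s (f v), hs _⟩) ▸ .rfl
      · exact SimpleGraph.Adj.reachable h
    have : Nonempty (f ⁻¹' {w}) := ⟨⟨s w, hs w⟩⟩
    exact ⟨fun u v => (reach u).trans (reach v).symm⟩
  · obtain ⟨u, v, hu, hv, huv⟩ := hedge w₁ w₂ h
    exact ⟨u, hu, v, hv, huv⟩

/-- The map on hub vertices that contracts the triangle `h¹t₁t₂` onto `h¹`. -/
def contractTriangle (i : Fin 12) : Fin 10 :=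
  if h : (i : ℕ) < 10 then ⟨i, h⟩ else 0

theorem exists_circBase_of_mem_bulletBase :
    ∀ p ∈ bulletBase, ∃ q ∈ circBase, q.1 ≠ q.2 ∧
      contractTriangle q.1 = p.1 ∧ contractTriangle q.2 = p.2 := by
  decide

theorem eq_or_mem_circBase_contractTriangle (i : Fin 12) :
    i = (contractTriangle i).castLE (by decide : 10 ≤ 12) ∨
      i ≠ (contractTriangle i).castLE (by decide : 10 ≤ 12) ∧
        ((contractTriangle i).castLE (by decide : 10 ≤ 12), i) ∈ circBase := by
  revert i
  decide

theorem contractTriangle_castLE (i : Fin 10) :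
    contractTriangle (i.castLE (by decide : 10 ≤ 12)) = i := by
  revert i
  decide

theorem gCirc_hasMinor_gBullet (n : ℕ) (hn : 11 ≤ n) :
    HasMinor (GCirc (n + 2)) (GBullet n) := by
  have hcard : n + 2 - 12 = n - 10 := by omega
  have hlast : n + 2 - 13 = n - 11 := by omega
  refine HasMinor.of_star_fibers (Sum.map contractTriangle (Fin.cast hcard))
    (Sum.map (Fin.castLE (by decide : 10 ≤ 12)) (Fin.cast hcard.symm)) ?_ ?_ ?_
  · rintro (i | k)
    · simp [contractTriangle_castLE]
    · simp
  · rintro (i | k)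
    · rcases eq_or_mem_circBase_contractTriangle i with h | ⟨hne, h⟩
      · exact .inl (congrArg Sum.inl h)
      · exact .inr ((SimpleGraph.fromRel_adj _ _ _).2
          ⟨fun e => hne (Sum.inl.inj e), .inr h⟩)
    · simp
  · -- It suffices to lift the relation that generates the edges, in one orientation.
    have lift_edge (a b : Fin 10 ⊕ Fin (n - 10))
        (h : match a, b with
          | Sum.inl i, Sum.inl j => (i, j) ∈ bulletBase
          | Sum.inl i, Sum.inr k =>
              (i = 2 ∧ (k : ℕ) = 0) ∨ (i = 4 ∧ (k : ℕ) = n - 11) ∨ i = 1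
          | Sum.inr _, Sum.inl _ => False
          | Sum.inr k, Sum.inr l => (l : ℕ) = (k : ℕ) + 1) (hab : a ≠ b) :
        ∃ u v, Sum.map contractTriangle (Fin.cast hcard) u = a ∧
          Sum.map contractTriangle (Fin.cast hcard) v = b ∧ (GCirc (n + 2)).Adj u v := by
      rcases a with i | k <;> rcases b with j | l
      · obtain ⟨⟨x, y⟩, hq, hne, hx, hy⟩ := exists_circBase_of_mem_bulletBase _ h
        exact ⟨.inl x, .inl y, congrArg Sum.inl hx, congrArg Sum.inl hy,
          (SimpleGraph.fromRel_adj _ _ _).2 ⟨fun e => hne (Sum.inl.inj e), .inl hq⟩⟩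
      · refine ⟨.inl (i.castLE (by decide : 10 ≤ 12)), .inr (l.cast hcard.symm),
          congrArg Sum.inl (contractTriangle_castLE i), by simp,
          (SimpleGraph.fromRel_adj _ _ _).2 ⟨Sum.inl_ne_inr, .inl ?_⟩⟩
        rcases h with ⟨rfl, h⟩ | ⟨rfl, h⟩ | rfl
        · exact .inl ⟨rfl, h⟩
        · exact .inr (.inl ⟨rfl, h.trans hlast.symm⟩)
        · exact .inr (.inr rfl)
      · exact h.elim
      · refine ⟨.inr (k.cast hcard.symm), .inr (l.cast hcard.symm), by simp, by simp,
          (SimpleGraph.fromRel_adj _ _ _).2 ⟨fun e => hab ?_, .inl h⟩⟩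
        simpa using e
    intro a b hab
    obtain ⟨hne, h | h⟩ := (SimpleGraph.fromRel_adj _ _ _).1 hab
    · exact lift_edge a b h hne
    · obtain ⟨u, v, hu, hv, huv⟩ := lift_edge b a h hne.symm
      exact ⟨v, u, hv, hu, huv.symm⟩
end

section
/- The graph obtained from G_13^∘ by adding the edge h₂h² does not contain the complete bipartite graph K_{2,6} as a minor. -/
/-- `G_13^∘` together with the extra edge `h₂h²` (vertices `Sum.inl 3` and `Sum.inl 1`). -/
def GCirc13Plus : SimpleGraph (Fin 12 ⊕ Fin (13 - 12)) :=
  GCirc 13 ⊔ SimpleGraph.fromEdgeSet {s(Sum.inl 3, Sum.inl 1)}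

namespace GCirc13

/-- The position of a vertex of `GCirc13Plus` in a bit mask. -/
def index : Fin 12 ⊕ Fin (13 - 12) → ℕ
  | Sum.inl i => i
  | Sum.inr _ => 12

/-- The `k`-th binary digit of `m`. The definitions below call the arithmetic of `ℕ` directly,
without notation type classes, to make them fast to evaluate in the kernel. -/
def bit (m k : ℕ) : ℕ := Nat.mod (Nat.shiftRight m k) 2

/-- The mask of all neighbours in `GCirc13Plus` of the vertices in the mask `m`. -/
def nbrs (m : ℕ) : ℕ :=
  Nat.lor (Nat.mul (bit m 0) 3200)
    (Nat.lor (Nat.mul (bit m 1) 4892)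
    (Nat.lor (Nat.mul (bit m 2) 4538)
    (Nat.lor (Nat.mul (bit m 3) 886)
    (Nat.lor (Nat.mul (bit m 4) 4814)
    (Nat.lor (Nat.mul (bit m 5) 1036)
    (Nat.lor (Nat.mul (bit m 6) 2072)
    (Nat.lor (Nat.mul (bit m 7) 21)
    (Nat.lor (Nat.mul (bit m 8) 14)
    (Nat.lor (Nat.mul (bit m 9) 26)
    (Nat.lor (Nat.mul (bit m 10) 2081)
    (Nat.lor (Nat.mul (bit m 11) 1089)
    (Nat.mul (bit m 12) 22))))))))))))

/-- The number of ones among the last 13 bits of `m`. -/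
def popCount (m : ℕ) : ℕ :=
  Nat.add (bit m 0) (Nat.add (bit m 1) (Nat.add (bit m 2) (Nat.add (bit m 3)
    (Nat.add (bit m 4) (Nat.add (bit m 5) (Nat.add (bit m 6) (Nat.add (bit m 7)
    (Nat.add (bit m 8) (Nat.add (bit m 9) (Nat.add (bit m 10) (Nat.add (bit m 11)
    (bit m 12))))))))))))

/-- The complement of the mask `m`. -/
def outside (m : ℕ) : ℕ := Nat.xor 8191 m

/-- The neighbours of `x` outside `x` and `y`. -/
def freeNbrs (x y : ℕ) : ℕ := Nat.land (nbrs x) (outside (Nat.lor x y))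

/-- Grow `m` inside `s` along edges, at most `k` times; the value is `false` if this
stops at a proper part of `s`. -/
def fills : ℕ → ℕ → ℕ → Bool
  | 0, _, _ => true
  | k + 1, s, m => bif Nat.beq (Nat.lor m (Nat.land (nbrs m) s)) m then Nat.beq m s
      else fills k s (Nat.lor m (Nat.land (nbrs m) s))

/-- The condition satisfied by connected sets with at least six neighbours. -/
def isHub (m : ℕ) : Bool :=
  Nat.ble 6 (popCount (freeNbrs m m)) && fills 13 m (Nat.pow 2 (Nat.log2 m))

/-- The neighbours of `x` outside `x` and `y` that are also neighbours of `y`, or that have a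
neighbour outside `x`, `y` and the neighbourhood of `x`. -/
def gate (x y : ℕ) : ℕ :=
  Nat.land (freeNbrs x y)
    (Nat.lor (nbrs y) (nbrs (Nat.land (outside (Nat.lor x y)) (outside (nbrs x)))))

/-- If `x` and `y` are disjoint, then one of them has a gate with at most five vertices. -/
def smallGate (x y : ℕ) : Bool :=
  bif Nat.beq (Nat.land x y) 0 then
    bif Nat.ble 6 (popCount (freeNbrs x y)) then
      !(Nat.ble 6 (popCount (gate x y)) && Nat.ble 6 (popCount (gate y x)))
    else true
  else true

/-- The bounded universal quantifier over the numbers `k` with `m * 2 ^ n ≤ k < (m + 1) * 2 ^ n`,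
by bisection. The case distinction on `m` makes the kernel evaluate `m` early. -/
def forallMask : ℕ → ℕ → (ℕ → Bool) → Bool
  | 0, 0, p => p 0
  | 0, m + 1, p => p (m + 1)
  | n + 1, m, p => forallMask n (Nat.mul 2 m) p && forallMask n (Nat.add (Nat.mul 2 m) 1) p

/-- The connected sets of at most three vertices with at least six neighbours. -/
def smallHubs : List ℕ :=
  [2, 4, 6, 8, 10, 12, 14, 16, 18, 20, 22, 24, 26, 28, 36, 38, 40, 42, 44, 52, 56, 72, 74, 76,
   80, 82, 84, 88, 104, 132, 133, 134, 140, 144, 145, 146, 148, 152, 164, 208, 260, 262, 264, 266,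
   268, 274, 276, 280, 292, 296, 328, 388, 518, 520, 522, 524, 528, 530, 532, 536, 552, 584, 592,
   656, 1060, 1064, 2120, 2128, 4100, 4102, 4106, 4108, 4112, 4114, 4116, 4120, 4132, 4176, 4228,
   4240]

theorem forallMask_smallHubs :
    forallMask 13 0 (fun x => bif Nat.ble (popCount x) 3 && isHub x
      then smallHubs.any (Nat.beq x) else true) = true := by
  decide +kernel

theorem forallMask_smallGate :
    forallMask 13 0 (fun y => bif Nat.ble (popCount y) 6 && isHub y
      then smallHubs.all (fun x => smallGate x y) else true) = true := by
  decide +kernel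

theorem of_forallMask {p : ℕ → Bool} :
    ∀ {n m : ℕ}, forallMask n m p = true → ∀ k, m * 2 ^ n ≤ k → k < (m + 1) * 2 ^ n → p k = true
  | 0, 0, h, k, _, hk' => by
    obtain rfl : k = 0 := by omega
    exact h
  | 0, m + 1, h, k, hk, hk' => by
    obtain rfl : k = m + 1 := by omega
    exact h
  | n + 1, m, h, k, hk, hk' => by
    simp only [forallMask, Bool.and_eq_true] at h
    rw [pow_succ] at hk hk'
    rcases lt_or_ge k ((2 * m + 1) * 2 ^ n) with hlt | hge
    · exact of_forallMask h.1 k (le_of_eq_of_le (by simp only [Nat.mul_eq]; ring) hk) hlt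
    · exact of_forallMask h.2 k hge
        (lt_of_lt_of_eq hk' (by simp only [Nat.mul_eq, Nat.add_eq]; ring))

theorem bit_eq (m k : ℕ) : bit m k = (m.testBit k).toNat := by
  rw [Nat.toNat_testBit, ← Nat.shiftRight_eq_div_pow]
  rfl

theorem testBit_outside {i : ℕ} (hi : i < 13) (m : ℕ) :
    (outside m).testBit i = !m.testBit i := by
  have h : (8191 : ℕ).testBit i = true := by interval_cases i <;> rfl
  change (8191 ^^^ m).testBit i = _
  simp [Nat.testBit_xor, h]

theorem testBit_land (a b i : ℕ) : (Nat.land a b).testBit i = (a.testBit i && b.testBit i) :=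
  Nat.testBit_and a b i

theorem testBit_lor (a b i : ℕ) : (Nat.lor a b).testBit i = (a.testBit i || b.testBit i) :=
  Nat.testBit_or a b i

theorem testBit_freeNbrs {i : ℕ} (hi : i < 13) (x y : ℕ) :
    (freeNbrs x y).testBit i = true ↔
      (nbrs x).testBit i = true ∧ x.testBit i = false ∧ y.testBit i = false := by
  simp [freeNbrs, testBit_outside hi]

theorem testBit_gate (i x y : ℕ) :
    (gate x y).testBit i = true ↔ (freeNbrs x y).testBit i = true ∧
      ((nbrs y).testBit i = true ∨
        (nbrs (Nat.land (outside (Nat.lor x y)) (outside (nbrs x)))).testBit i = true) := by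
  simp [gate]

theorem popCount_eq_card (m : ℕ) :
    popCount m = ((Finset.range 13).filter fun i => m.testBit i = true).card := by
  have h (i : ℕ) : (if m.testBit i = true then 1 else 0) = bit m i := by
    rw [bit_eq]
    cases m.testBit i <;> rfl
  simp only [Finset.card_filter, h, Finset.sum_range_succ, Finset.sum_range_zero]
  simp only [popCount, Nat.add_eq]
  ring

theorem le_popCount {ι : Type*} [Fintype ι] {m : ℕ} (f : ι → ℕ) (hf : Function.Injective f)
    (h : ∀ i, f i < 13) (h' : ∀ i, m.testBit (f i) = true) : Fintype.card ι ≤ popCount m := by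
  classical
  rw [popCount_eq_card, ← Finset.card_univ, ← Finset.card_image_of_injective _ hf]
  apply Finset.card_le_card
  intro j hj
  obtain ⟨i, -, rfl⟩ := Finset.mem_image.1 hj
  simp [h, h']

theorem popCount_mono {a b : ℕ} (h : ∀ i < 13, a.testBit i = true → b.testBit i = true) :
    popCount a ≤ popCount b := by
  simp only [popCount_eq_card]
  apply Finset.card_le_card
  intro i hi
  simp only [Finset.mem_filter, Finset.mem_range] at hi ⊢
  exact ⟨hi.1, h i hi.1 hi.2⟩

theorem popCount_add_le {a b c : ℕ}
    (hab : ∀ i < 13, a.testBit i = true → b.testBit i = false)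
    (hc : ∀ i < 13, c.testBit i = true → a.testBit i = false ∧ b.testBit i = false) :
    popCount a + popCount b + popCount c ≤ 13 := by
  simp only [popCount_eq_card]
  rw [← Finset.card_union_of_disjoint, ← Finset.card_union_of_disjoint]
  · refine (Finset.card_le_card (t := Finset.range 13) ?_).trans_eq (Finset.card_range 13)
    intro i
    simp only [Finset.mem_union, Finset.mem_filter]
    tauto
  · rw [Finset.disjoint_left]
    intro i hi hi'
    simp only [Finset.mem_union, Finset.mem_filter, Finset.mem_range] at hi hi'
    have := hc i hi'.1 hi'.2
    grind
  · rw [Finset.disjoint_left]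
    intro i hi hi'
    simp only [Finset.mem_filter, Finset.mem_range] at hi hi'
    have := hab i hi'.1
    grind

theorem index_lt : ∀ v, index v < 13 := by
  decide

theorem index_injective : Function.Injective index := by
  unfold Function.Injective
  decide

theorem testBit_nbrs {i j m : ℕ} (hi : i < 13) (h : (nbrs (2 ^ i)).testBit j = true)
    (hm : m.testBit i = true) : (nbrs m).testBit j = true := by
  interval_cases i <;>
    simp only [nbrs, bit_eq, testBit_lor, hm, Bool.or_eq_true, Nat.testBit_two_pow] at h ⊢ <;>
    simp at h <;> simp [h]

theorem testBit_nbrs_of_adj {u v : Fin 12 ⊕ Fin (13 - 12)} (h : GCirc13Plus.Adj u v) :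
    (nbrs (2 ^ index u)).testBit (index v) = true := by
  have key : ∀ u v : Fin 12 ⊕ Fin (13 - 12),
      (nbrs (2 ^ index u)).testBit (index v) = false → ¬ GCirc13Plus.Adj u v := by
    rintro (i | i) (j | j) <;>
      simp only [GCirc13Plus, GCirc, SimpleGraph.sup_adj, SimpleGraph.fromRel_adj,
        SimpleGraph.fromEdgeSet_adj, Set.mem_singleton_iff, Sym2.eq_iff] <;>
      revert i j <;> decide
  by_contra hb
  exact key u v (by simpa using hb) h

open Classical in
/-- The bit mask of a set of vertices. -/
noncomputable def mask (X : Set (Fin 12 ⊕ Fin (13 - 12))) : ℕ :=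
  Nat.ofBits (n := 13) fun i => decide (∃ v ∈ X, index v = i)

theorem mask_lt (X : Set (Fin 12 ⊕ Fin (13 - 12))) : mask X < 8192 :=
  Nat.ofBits_lt_two_pow _

theorem testBit_mask {X : Set (Fin 12 ⊕ Fin (13 - 12))} {i : ℕ} :
    (mask X).testBit i = true ↔ ∃ v ∈ X, index v = i := by
  rw [mask, Nat.testBit_ofBits]
  split_ifs with h
  · simp
  · simp only [false_iff]
    rintro ⟨v, -, rfl⟩
    exact h (index_lt v)

theorem testBit_mask_index {X : Set (Fin 12 ⊕ Fin (13 - 12))} {v : Fin 12 ⊕ Fin (13 - 12)} :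
    (mask X).testBit (index v) = true ↔ v ∈ X := by
  simp [testBit_mask, index_injective.eq_iff]

/-- A connected set that meets both `P` and its complement has an edge leaving `P`. -/
theorem exists_adj_of_connected {V : Type*} {G : SimpleGraph V} {S : Set V}
    (hS : (G.induce S).Connected) {P : V → Prop} {u v : V} (hu : u ∈ S) (hv : v ∈ S)
    (hPu : P u) (hPv : ¬ P v) : ∃ p ∈ S, ∃ q ∈ S, G.Adj p q ∧ P p ∧ ¬ P q := by
  obtain ⟨w⟩ := hS.preconnected ⟨u, hu⟩ ⟨v, hv⟩
  obtain ⟨d, -, hd, hd'⟩ := w.exists_boundary_dart {x | P x} hPu hPv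
  exact ⟨d.fst, d.fst.2, d.snd, d.snd.2, d.adj, hd, hd'⟩

theorem fills_mask {X : Set (Fin 12 ⊕ Fin (13 - 12))} (hX : (GCirc13Plus.induce X).Connected)
    (k m : ℕ) (hm : ∃ v ∈ X, m.testBit (index v) = true)
    (hmX : ∀ i, m.testBit i = true → (mask X).testBit i = true) : fills k (mask X) m = true := by
  induction k generalizing m with
  | zero => rfl
  | succ k ih =>
    rw [fills]
    cases hb : Nat.beq (Nat.lor m (Nat.land (nbrs m) (mask X))) m with
    | true =>
      have hb := Nat.eq_of_beq_eq_true hb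
      obtain ⟨v, hv, hvm⟩ := hm
      suffices m = mask X by simp [this]
      refine Nat.eq_of_testBit_eq fun i => Bool.eq_iff_iff.2 ⟨hmX i, fun hi => ?_⟩
      obtain ⟨w, hw, rfl⟩ := testBit_mask.1 hi
      by_contra hwm
      obtain ⟨p, -, q, hq, hpq, hp, hqm⟩ :=
        exists_adj_of_connected (P := fun v => m.testBit (index v) = true) hX hv hw hvm hwm
      apply hqm
      rw [← hb, testBit_lor, testBit_land, testBit_mask_index.2 hq,
        testBit_nbrs (index_lt p) (testBit_nbrs_of_adj hpq) hp]
      simp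
    | false =>
      refine ih _ ?_ ?_
      · obtain ⟨v, hv, hvm⟩ := hm
        exact ⟨v, hv, by simp [hvm]⟩
      · intro i hi
        simp only [testBit_lor, testBit_land, Bool.or_eq_true, Bool.and_eq_true] at hi
        exact hi.elim (hmX i) And.right

theorem isHub_mask {X : Set (Fin 12 ⊕ Fin (13 - 12))} (hX : (GCirc13Plus.induce X).Connected)
    (h : 6 ≤ popCount (freeNbrs (mask X) (mask X))) : isHub (mask X) = true := by
  simp only [isHub, Bool.and_eq_true]
  refine ⟨Nat.ble_eq_true_of_le h, ?_⟩
  obtain ⟨⟨v, hv⟩⟩ := hX.nonempty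
  have h0 : mask X ≠ 0 := by
    intro h
    have := testBit_mask_index.2 hv
    simp [h] at this
  have hlog : (mask X).testBit (Nat.log2 (mask X)) = true := Nat.testBit_log2 h0
  apply fills_mask hX
  · obtain ⟨w, hw, hw'⟩ := testBit_mask.1 hlog
    exact ⟨w, hw, by rw [hw']; exact Nat.testBit_two_pow_self⟩
  · intro i hi
    have hi : (2 ^ (mask X).log2).testBit i = true := hi
    rw [Nat.testBit_two_pow] at hi
    rwa [← of_decide_eq_true hi]

/-- A connected set disjoint from `X` and `Y` and adjacent to both meets the gate. -/
theorem exists_mem_gate {X Y L : Set (Fin 12 ⊕ Fin (13 - 12))} (hXL : Disjoint X L)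
    (hYL : Disjoint Y L) (hL : (GCirc13Plus.induce L).Connected)
    (hX : ∃ u ∈ X, ∃ v ∈ L, GCirc13Plus.Adj u v) (hY : ∃ u ∈ Y, ∃ v ∈ L, GCirc13Plus.Adj u v) :
    ∃ v ∈ L, (gate (mask X) (mask Y)).testBit (index v) = true := by
  have touch {Z : Set (Fin 12 ⊕ Fin (13 - 12))} {u v} (hu : u ∈ Z) (h : GCirc13Plus.Adj u v) :
      (nbrs (mask Z)).testBit (index v) = true :=
    testBit_nbrs (index_lt u) (testBit_nbrs_of_adj h) (testBit_mask_index.2 hu)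
  have avoid {Z : Set (Fin 12 ⊕ Fin (13 - 12))} (h : Disjoint Z L) {v} (hv : v ∈ L) :
      (mask Z).testBit (index v) = false := by
    rw [Bool.eq_false_iff, ne_eq, testBit_mask_index]
    exact fun hv' => Set.disjoint_left.1 h hv' hv
  obtain ⟨x, hx, v, hv, hxv⟩ := hX
  obtain ⟨y, hy, w, hw, hyw⟩ := hY
  have free {v} (hv : v ∈ L) (h : (nbrs (mask X)).testBit (index v) = true) :
      (freeNbrs (mask X) (mask Y)).testBit (index v) = true :=
    (testBit_freeNbrs (index_lt v) _ _).2 ⟨h, avoid hXL hv, avoid hYL hv⟩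
  by_cases hall : ∀ q ∈ L, (nbrs (mask X)).testBit (index q) = true
  · exact ⟨w, hw, (testBit_gate _ _ _).2 ⟨free hw (hall w hw), Or.inl (touch hy hyw)⟩⟩
  · push Not at hall
    obtain ⟨q, hq, hqX⟩ := hall
    obtain ⟨p, hp, r, hr, hpr, hpX, hrX⟩ :=
      exists_adj_of_connected (P := fun v => (nbrs (mask X)).testBit (index v) = true)
        hL hv hq (touch hx hxv) (by simpa using hqX)
    refine ⟨p, hp, (testBit_gate _ _ _).2 ⟨free hp hpX, Or.inr ?_⟩⟩
    refine testBit_nbrs (index_lt r) (testBit_nbrs_of_adj hpr.symm) ?_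
    simpa [testBit_outside (index_lt r), avoid hXL hr, avoid hYL hr]
      using hrX

theorem six_le_popCount_gate {X Y : Set (Fin 12 ⊕ Fin (13 - 12))}
    {L : Fin 6 → Set (Fin 12 ⊕ Fin (13 - 12))} (hXL : ∀ i, Disjoint X (L i))
    (hYL : ∀ i, Disjoint Y (L i)) (hLL : ∀ i j, i ≠ j → Disjoint (L i) (L j))
    (hL : ∀ i, (GCirc13Plus.induce (L i)).Connected)
    (hX : ∀ i, ∃ u ∈ X, ∃ v ∈ L i, GCirc13Plus.Adj u v)
    (hY : ∀ i, ∃ u ∈ Y, ∃ v ∈ L i, GCirc13Plus.Adj u v) :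
    6 ≤ popCount (gate (mask X) (mask Y)) := by
  choose f hf hfg using fun i => exists_mem_gate (hXL i) (hYL i) (hL i) (hX i) (hY i)
  refine le_popCount (ι := Fin 6) (fun i => index (f i)) ?_ (fun i => index_lt _) hfg
  intro i j hij
  by_contra hne
  exact Set.disjoint_left.1 (hLL i j hne) (hf i) (index_injective hij ▸ hf j)

/-- Two disjoint connected sets cannot be joined by six further disjoint connected sets. -/
theorem not_hubs_of_popCount_le {X Y : Set (Fin 12 ⊕ Fin (13 - 12))}
    {L : Fin 6 → Set (Fin 12 ⊕ Fin (13 - 12))} (hle : popCount (mask X) ≤ popCount (mask Y))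
    (hcX : (GCirc13Plus.induce X).Connected) (hcY : (GCirc13Plus.induce Y).Connected)
    (hXY : Disjoint X Y) (hXL : ∀ i, Disjoint X (L i))
    (hYL : ∀ i, Disjoint Y (L i)) (hLL : ∀ i j, i ≠ j → Disjoint (L i) (L j))
    (hL : ∀ i, (GCirc13Plus.induce (L i)).Connected)
    (hX : ∀ i, ∃ u ∈ X, ∃ v ∈ L i, GCirc13Plus.Adj u v)
    (hY : ∀ i, ∃ u ∈ Y, ∃ v ∈ L i, GCirc13Plus.Adj u v) : False := by
  have hgX := six_le_popCount_gate hXL hYL hLL hL hX hY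
  have hgY := six_le_popCount_gate hYL hXL hLL hL hY hX
  have hfree (x y : ℕ) : popCount (gate x y) ≤ popCount (freeNbrs x y) :=
    popCount_mono fun i _ h => ((testBit_gate i x y).1 h).1
  have hfree' (x y : ℕ) : popCount (freeNbrs x y) ≤ popCount (freeNbrs x x) :=
    popCount_mono fun i hi h => by
      rw [testBit_freeNbrs hi] at h ⊢
      exact ⟨h.1, h.2.1, h.2.1⟩
  have hsum :
      popCount (mask X) + popCount (mask Y) + popCount (freeNbrs (mask X) (mask Y)) ≤ 13 := by
    refine popCount_add_le (fun i _ hi => ?_) fun i hi h => ((testBit_freeNbrs hi _ _).1 h).2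
    rw [Bool.eq_false_iff, ne_eq, testBit_mask]
    rintro ⟨v, hv, rfl⟩
    exact Set.disjoint_left.1 hXY (testBit_mask_index.1 hi) hv
  have hpos : 1 ≤ popCount (mask X) := by
    obtain ⟨⟨v, hv⟩⟩ := hcX.nonempty
    exact le_popCount (fun _ : Unit => index v) (fun _ _ _ => rfl) (fun _ => index_lt v)
      fun _ => testBit_mask_index.2 hv
  have h1 := hfree (mask X) (mask Y)
  have h2 := hfree (mask Y) (mask X)
  have hubX := isHub_mask hcX ((hgX.trans h1).trans (hfree' _ _))
  have hubY := isHub_mask hcY ((hgY.trans h2).trans (hfree' _ _))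
  have hX3 : Nat.ble (popCount (mask X)) 3 = true := Nat.ble_eq_true_of_le (by omega)
  have hY6 : Nat.ble (popCount (mask Y)) 6 = true := Nat.ble_eq_true_of_le (by omega)
  have hmem := of_forallMask forallMask_smallHubs (mask X) (by simp) (by simpa using mask_lt X)
  have hall := of_forallMask forallMask_smallGate (mask Y) (by simp) (by simpa using mask_lt Y)
  simp only [hX3, hY6, hubX, hubY, Bool.and_self, cond_true, List.any_eq_true, List.all_eq_true]
    at hmem hall
  obtain ⟨x, hx, hxX⟩ := hmem
  obtain rfl := Nat.eq_of_beq_eq_true hxX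
  have hdisj : Nat.land (mask X) (mask Y) = 0 := by
    refine Nat.eq_of_testBit_eq fun i => ?_
    rw [testBit_land, Nat.zero_testBit, Bool.eq_false_iff, ne_eq, Bool.and_eq_true]
    rintro ⟨hi, hi'⟩
    obtain ⟨v, hv, rfl⟩ := testBit_mask.1 hi
    exact Set.disjoint_left.1 hXY hv (testBit_mask_index.1 hi')
  have := hall _ hx
  rw [smallGate, hdisj, Nat.ble_eq_true_of_le (hgX.trans h1), Nat.ble_eq_true_of_le hgX,
    Nat.ble_eq_true_of_le hgY] at this
  simp at this

end GCirc13

open GCirc13 in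
theorem gCirc13_plus_h2h2_no_K26_minor :
    ¬ HasMinor GCirc13Plus (completeBipartiteGraph (Fin 2) (Fin 6)) := by
  rintro ⟨B, -, hd, hc, he⟩
  have hXY : Disjoint (B (Sum.inl 0)) (B (Sum.inl 1)) := hd _ _ (by simp)
  have hXL (k : Fin 2) (i : Fin 6) : Disjoint (B (Sum.inl k)) (B (Sum.inr i)) := hd _ _ (by simp)
  have hLL (i j : Fin 6) (h : i ≠ j) : Disjoint (B (Sum.inr i)) (B (Sum.inr j)) :=
    hd _ _ (by simpa using h)
  have hX (k : Fin 2) (i : Fin 6) :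
      ∃ u ∈ B (Sum.inl k), ∃ v ∈ B (Sum.inr i), GCirc13Plus.Adj u v := he _ _ (by simp)
  rcases le_total (popCount (mask (B (Sum.inl 0)))) (popCount (mask (B (Sum.inl 1)))) with h | h
  · exact not_hubs_of_popCount_le h (hc _) (hc _) hXY (hXL 0) (hXL 1) hLL
      (fun i => hc (Sum.inr i)) (hX 0) (hX 1)
  · exact not_hubs_of_popCount_le h (hc _) (hc _) hXY.symm (hXL 1) (hXL 0) hLL
      (fun i => hc (Sum.inr i)) (hX 1) (hX 0)
end

section
/- The graph H₁₃ is not hamiltonian. -/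
/-- Vertex labels in `Fin 13`: `0 = h¹`, `1 = h²`, `2 = h₁`, `3 = h₃`, `4 = h₁¹`,
`5 = h₂¹`, `6 = h₃¹`, `7 = h₁²`, `8 = h₂²`, `9 = h₃²`, `10 = a`, `11 = u`, `12 = b`.
These are the edges of the Herschel graph not incident with `h₂`, together with
the new edges `au`, `ub`, `ah₁¹`, `ah₁²`, `bh₂¹`, `bh₂²`, and `uh²`. -/
def h13Edges : List (Fin 13 × Fin 13) :=
  [(0,4),(0,5),(0,6),(1,7),(1,8),(1,9),
   (2,4),(2,7),(2,6),(2,9),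
   (3,6),(3,9),(3,5),(3,8),
   (10,11),(11,12),(10,4),(10,7),(12,5),(12,8),(11,1)]

/-- The graph `H₁₃`, obtained from the Herschel graph by deleting `h₂` and adding
the path `a, u, b` with `a` joined to `h₁¹, h₁²`, `b` joined to `h₂¹, h₂²`, and
`u` joined to `h²`. -/
def H13 : SimpleGraph (Fin 13) :=
  SimpleGraph.fromRel (fun a b => (a, b) ∈ h13Edges)

/-- A Hamiltonian graph with a 2-coloring and more than one vertex has an even number of vertices. -/
theorem SimpleGraph.IsHamiltonian.even_card {V : Type*} [Fintype V] [DecidableEq V]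
    {G : SimpleGraph V} (hG : G.IsHamiltonian) (c : G.Coloring Bool)
    (hV : Fintype.card V ≠ 1) : Even (Fintype.card V) := by
  obtain ⟨v, p, hp⟩ := hG hV
  rw [← hp.length_eq]
  exact (c.even_length_iff_congr p).mpr Iff.rfl

/-- The bipartition of `H13`. -/
def h13Coloring : H13.Coloring Bool :=
  SimpleGraph.Coloring.mk (fun v => decide (v ∈ ({0, 1, 2, 3, 10, 12} : Finset (Fin 13)))) (by
    simp only [H13, SimpleGraph.fromRel_adj]
    decide)

theorem h13_not_hamiltonian : ¬ H13.IsHamiltonian := by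
  intro h
  exact absurd (h.even_card h13Coloring (by simp)) (by decide)
end
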